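/- Let V be a singular Minkowski space, v ∈ V with ‖v‖ = 1, (t_k) a sequence of reals with t_k → +∞, and (w_k) a sequence in V with w_k → w₀. Set x_k = t_k·v + w_k (so (x_k) is a flag-directed sequence of level 1 with directing ray in direction v and asymptotic line through w₀). Then for every y ∈ V both limits below exist and are equal: lim_{k→∞}(‖y − x_k‖ − ‖x_k‖) = lim_{t→∞}(‖y − w₀ − t·v‖ − ‖w₀ + t·v‖). In other words, the normalized distance functions of (x_k) converge pointwise to the Busemann function of the ray t ↦ w₀ + t·v, normalized to vanish at the origin. -/

import Mathlib

open Filter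

/-- Along a ray with unit direction the norm, minus arc length, converges. -/
theorem exists_tendsto_norm_add_smul_sub {V : Type*} [NormedAddCommGroup V] [NormedSpace ℝ V]
    {v : V} (hv : ‖v‖ = 1) (u : V) :
    ∃ b : ℝ, Tendsto (fun s : ℝ => ‖u + s • v‖ - s) atTop (nhds b) := by
  refine ⟨_, tendsto_atTop_ciInf (fun r s hrs => ?_) ⟨-‖u‖, ?_⟩⟩
  · have h : ‖u + s • v‖ ≤ ‖u + r • v‖ + ‖(s - r) • v‖ := by
      rw [show u + s • v = (u + r • v) + (s - r) • v by module]
      exact norm_add_le _ _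
    rw [norm_smul, hv, mul_one, Real.norm_of_nonneg (sub_nonneg.2 hrs)] at h
    change ‖u + s • v‖ - s ≤ ‖u + r • v‖ - r
    linarith
  · rintro _ ⟨s, rfl⟩
    have h := norm_sub_le (u + s • v) u
    rw [add_sub_cancel_left, norm_smul, hv, mul_one, Real.norm_eq_abs] at h
    have := le_abs_self s
    change -‖u‖ ≤ ‖u + s • v‖ - s
    linarith

/-- The limit along a ray is unchanged when the base point is replaced by a convergent
sequence. -/
theorem tendsto_norm_add_smul_sub_of_tendsto {V : Type*} [NormedAddCommGroup V]
    [NormedSpace ℝ V] {v u₀ : V} {b : ℝ}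
    (hb : Tendsto (fun s : ℝ => ‖u₀ + s • v‖ - s) atTop (nhds b))
    {t : ℕ → ℝ} (ht : Tendsto t atTop atTop) {u : ℕ → V} (hu : Tendsto u atTop (nhds u₀)) :
    Tendsto (fun k => ‖u k + t k • v‖ - t k) atTop (nhds b) := by
  refine (hb.comp ht).congr_dist
    (squeeze_zero (fun _ => dist_nonneg) (fun k => ?_) (tendsto_iff_dist_tendsto_zero.1 hu))
  rw [Function.comp_apply, dist_sub_right, dist_comm]
  exact (dist_norm_norm_le _ _).trans_eq (by rw [← dist_eq_norm, dist_add_right])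

/-- For a flag-directed sequence of level 1, `x_k = t_k • v + w_k` with `t_k → +∞` and
`w_k → w₀`, the normalized distance functions converge pointwise to the Busemann
function of the ray `t ↦ w₀ + t • v`, normalized to vanish at the origin. -/
theorem level_one_flag_directed_busemann {V : Type*} [NormedAddCommGroup V]
    [NormedSpace ℝ V] [FiniteDimensional ℝ V]
    (hsc : ∀ x y : V, ‖x‖ = 1 → ‖y‖ = 1 → x ≠ y → ‖(2 : ℝ)⁻¹ • (x + y)‖ < 1)
    (v : V) (hv : ‖v‖ = 1)
    (t : ℕ → ℝ) (ht : Tendsto t atTop atTop)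
    (w : ℕ → V) (w₀ : V) (hw : Tendsto w atTop (nhds w₀)) :
    ∀ y : V, ∃ L : ℝ,
      Tendsto (fun k => ‖y - (t k • v + w k)‖ - ‖t k • v + w k‖) atTop (nhds L) ∧
      Tendsto (fun s : ℝ => ‖y - w₀ - s • v‖ - ‖w₀ + s • v‖) atTop (nhds L) := by
  intro y
  obtain ⟨b, hb⟩ := exists_tendsto_norm_add_smul_sub hv (w₀ - y)
  obtain ⟨c, hc⟩ := exists_tendsto_norm_add_smul_sub hv w₀
  refine ⟨b - c, ?_, ?_⟩
  · refine ((tendsto_norm_add_smul_sub_of_tendsto hb ht (hw.sub_const y)).sub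
      (tendsto_norm_add_smul_sub_of_tendsto hc ht hw)).congr fun k => ?_
    rw [sub_sub_sub_cancel_right, norm_sub_rev y, add_comm (t k • v), sub_add_eq_add_sub]
  · refine (hb.sub hc).congr fun s => ?_
    rw [sub_sub_sub_cancel_right, sub_sub, norm_sub_rev y, sub_add_eq_add_sub]
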